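/- arXiv:2311.12607 — 3 statements merged into one kernel-verified Lean document; each statement's English description precedes it below -/
import Mathlib

section
/- Let N ≥ 1 and consider the periodic response matrix M_N := H(I−F)^{-1}G + J. Then the conjugated matrix 𝓕_N^* M_N 𝓕_N is diagonal, with m-th diagonal entry equal to P(e^{−iω_m}) where ω_m = 2πm/N and P(z) = D + C(zI − A)^{-1}B is the transfer function of the system, for m = 0, 1, …, N−1. -/
open Matrix Complex

noncomputable section

/-- The `N × N` unitary DFT matrix with `(p,q)` entry `W_N^{p·q} / √N`,
where `W_N = e^{-2πi/N}`. -/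
def dftMatrix (N : ℕ) : Matrix (Fin N) (Fin N) ℂ :=
  Matrix.of fun p q =>
    ((1 / Real.sqrt N : ℝ) : ℂ) *
      Complex.exp (-(2 * Real.pi * Complex.I) / N) ^ ((p : ℕ) * (q : ℕ))

/-- `G = [A^{N-1}B, A^{N-2}B, …, B]`. -/
def liftedG (n N : ℕ) (A : Matrix (Fin n) (Fin n) ℝ) (B : Fin n → ℝ) :
    Matrix (Fin n) (Fin N) ℝ :=
  Matrix.of fun i q => ((A ^ (N - 1 - (q : ℕ))) *ᵥ B) i

/-- `H` with rows `C, CA, …, CA^{N-1}`. -/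
def liftedH (n N : ℕ) (A : Matrix (Fin n) (Fin n) ℝ) (C : Fin n → ℝ) :
    Matrix (Fin N) (Fin n) ℝ :=
  Matrix.of fun p i => (C ᵥ* (A ^ (p : ℕ))) i

/-- `J`, the lower-triangular Toeplitz matrix with `(p,q)` entry `D` if `p = q`,
`C A^{p-q-1} B` if `p > q`, and `0` otherwise. -/
def liftedJ (n N : ℕ) (A : Matrix (Fin n) (Fin n) ℝ) (B C : Fin n → ℝ) (D : ℝ) :
    Matrix (Fin N) (Fin N) ℝ :=
  Matrix.of fun p q =>
    if (p : ℕ) = (q : ℕ) then D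
    else if (q : ℕ) < (p : ℕ) then C ⬝ᵥ ((A ^ ((p : ℕ) - (q : ℕ) - 1)) *ᵥ B)
    else 0

/-- The transfer function `P(z) = D + C (zI - A)⁻¹ B`. -/
def transferFn (n : ℕ) (A : Matrix (Fin n) (Fin n) ℝ) (B C : Fin n → ℝ) (D : ℝ)
    (z : ℂ) : ℂ :=
  (D : ℂ) + (fun i => (C i : ℂ)) ⬝ᵥ
    (((z • (1 : Matrix (Fin n) (Fin n) ℂ) - A.map Complex.ofReal)⁻¹) *ᵥ fun i => (B i : ℂ))

/-- The periodic response matrix `M_N = H (I - F)⁻¹ G + J` with `F = A^N`. -/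
def periodicResponse (n N : ℕ) (A : Matrix (Fin n) (Fin n) ℝ) (B C : Fin n → ℝ) (D : ℝ) :
    Matrix (Fin N) (Fin N) ℝ :=
  liftedH n N A C * (1 - A ^ N)⁻¹ * liftedG n N A B + liftedJ n N A B C D

lemma dftAux_prim (N : ℕ) (hN : 1 ≤ N) :
    IsPrimitiveRoot (Complex.exp (-(2 * Real.pi * Complex.I) / N)) N := by
  have h := (Complex.isPrimitiveRoot_exp N (by omega)).inv
  rw [← Complex.exp_neg] at h
  rwa [neg_div]

lemma dftAux_norm (N : ℕ) (hN : 1 ≤ N) :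
    ‖Complex.exp (-(2 * Real.pi * Complex.I) / N)‖ = 1 :=
  (dftAux_prim N hN).norm'_eq_one (by omega)

lemma dftAux_unitary (N : ℕ) (hN : 1 ≤ N) : (dftMatrix N)ᴴ * dftMatrix N = 1 := by
  have hp := dftAux_prim N hN
  have hn := dftAux_norm N hN
  ext a b
  rw [Matrix.mul_apply]
  simp only [Matrix.conjTranspose_apply, dftMatrix, Matrix.of_apply]
  generalize Complex.exp (-(2 * Real.pi * Complex.I) / N) = W at hp hn
  have hW0 : W ≠ 0 := by
    intro h; simp [h] at hn
  have hstar : star W = W⁻¹ := by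
    rw [Complex.inv_eq_conj hn]; rfl
  have hs : ((1 / Real.sqrt N : ℝ) : ℂ) * ((1 / Real.sqrt N : ℝ) : ℂ) = (N : ℂ)⁻¹ := by
    rw [← Complex.ofReal_mul]
    rw [div_mul_div_comm, Real.mul_self_sqrt (by positivity)]
    simp
  have hN0 : (N : ℂ) ≠ 0 := by
    exact_mod_cast (by omega : N ≠ 0)
  have hterm : ∀ p : Fin N,
      star (((1 / Real.sqrt N : ℝ) : ℂ) * W ^ ((p : ℕ) * (a : ℕ))) *
        (((1 / Real.sqrt N : ℝ) : ℂ) * W ^ ((p : ℕ) * (b : ℕ))) =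
      (N : ℂ)⁻¹ * ((W⁻¹ ^ (a : ℕ) * W ^ (b : ℕ)) ^ (p : ℕ)) := by
    intro p
    have h1 : star ((1 / Real.sqrt N : ℝ) : ℂ) = ((1 / Real.sqrt N : ℝ) : ℂ) :=
      Complex.conj_ofReal _
    rw [star_mul, star_pow, hstar, h1, ← hs, mul_pow, ← pow_mul, ← pow_mul,
      mul_comm (a : ℕ), mul_comm (b : ℕ)]
    ring
  rw [Finset.sum_congr rfl (fun p _ => hterm p), ← Finset.mul_sum,
    Fin.sum_univ_eq_sum_range (fun p => (W⁻¹ ^ (a : ℕ) * W ^ (b : ℕ)) ^ p) N]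
  by_cases hab : a = b
  · subst hab
    have : W⁻¹ ^ (a : ℕ) * W ^ (a : ℕ) = 1 := by
      rw [← mul_pow, inv_mul_cancel₀ hW0, one_pow]
    rw [this, Matrix.one_apply_eq]
    simp [hN0]
  · rw [Matrix.one_apply_ne hab]
    have hr : W⁻¹ ^ (a : ℕ) * W ^ (b : ℕ) ≠ 1 := by
      intro h
      apply hab
      rw [inv_pow, inv_mul_eq_one₀ (pow_ne_zero _ hW0)] at h
      exact Fin.ext (hp.pow_inj a.2 b.2 h)
    have hrN : (W⁻¹ ^ (a : ℕ) * W ^ (b : ℕ)) ^ N = 1 := by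
      rw [mul_pow, ← pow_mul, ← pow_mul, mul_comm (a : ℕ), mul_comm (b : ℕ), pow_mul, pow_mul,
        inv_pow, hp.pow_eq_one]
      simp
    rw [geom_sum_eq hr, hrN]
    simp

lemma geomAux {n : ℕ} (A : Matrix (Fin n) (Fin n) ℂ) (z : ℂ) (k : ℕ)
    (x b : Fin n → ℂ) (hx : (z • (1 : Matrix (Fin n) (Fin n) ℂ) - A) *ᵥ x = b) :
    ∑ q ∈ Finset.range k, z ^ q • ((A ^ (k - 1 - q)) *ᵥ b) = z ^ k • x - (A ^ k) *ᵥ x := by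
  have hc : Commute (z • (1 : Matrix (Fin n) (Fin n) ℂ)) A :=
    (Commute.one_left A).smul_left z
  have h := hc.geom_sum₂_mul k
  have h2 := congrArg (fun M => M *ᵥ x) h
  simp only [← Matrix.mulVec_mulVec, hx, Matrix.sum_mulVec, Matrix.sub_mulVec] at h2
  simpa [smul_pow, Matrix.smul_mulVec] using h2

lemma eigenAux (n N : ℕ) (hN : 1 ≤ N)
    (A : Matrix (Fin n) (Fin n) ℝ) (B C : Fin n → ℝ) (D : ℝ)
    (hA : ∀ μ ∈ spectrum ℂ (A.map Complex.ofReal), ‖μ‖ < 1) (z : ℂ) (hz : z ^ N = 1)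
    (p : Fin N) :
    (((periodicResponse n N A B C D).map Complex.ofReal) *ᵥ fun q : Fin N => z ^ (q : ℕ)) p =
      z ^ (p : ℕ) * transferFn n A B C D z := by
  have hzn : ‖z‖ = 1 := Complex.norm_eq_one_of_pow_eq_one hz (by omega)
  set Ac := A.map Complex.ofReal with hAc
  have hmap : ∀ k, (A ^ k).map Complex.ofReal = Ac ^ k := fun k =>
    map_pow (Complex.ofRealHom.mapMatrix (m := Fin n)) A k
  -- invertibility
  have hu1 : IsUnit (z • (1 : Matrix (Fin n) (Fin n) ℂ) - Ac) := by
    by_contra h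
    have : z ∈ spectrum ℂ Ac := by
      rw [spectrum.mem_iff, Algebra.algebraMap_eq_smul_one]; exact h
    have := hA z this
    linarith
  have hu2 : IsUnit (1 - Ac ^ N) := by
    by_contra h
    have h1 : (1 : ℂ) ∈ spectrum ℂ (Ac ^ N) := by
      rw [spectrum.mem_iff, map_one]; exact h
    rw [spectrum.map_pow_of_pos Ac (by omega)] at h1
    obtain ⟨μ, hμ, hμN⟩ := h1
    have h2 := hA μ hμ
    have h3 : ‖μ‖ = 1 := Complex.norm_eq_one_of_pow_eq_one hμN (by omega)
    linarith
  have hm1 : (1 - A ^ N).map Complex.ofReal = 1 - Ac ^ N := by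
    rw [← hmap]
    exact (map_sub (Complex.ofRealHom.mapMatrix (m := Fin n)) 1 (A ^ N)).trans (by
      rw [map_one]; rfl)
  have hdet : IsUnit (1 - A ^ N).det := by
    have h1 := (Matrix.isUnit_iff_isUnit_det _).1 hu2
    rw [← hm1] at h1
    have h2 : ((1 - A ^ N).map Complex.ofReal).det = (((1 - A ^ N).det : ℝ) : ℂ) :=
      (RingHom.map_det Complex.ofRealHom (1 - A ^ N)).symm
    rw [h2] at h1
    rw [isUnit_iff_ne_zero] at h1 ⊢
    exact_mod_cast h1
  set X := ((1 - A ^ N)⁻¹).map Complex.ofReal with hX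
  have hXmul : X * (1 - Ac ^ N) = 1 := by
    have h1 := congrArg (Complex.ofRealHom.mapMatrix (m := Fin n)) (Matrix.nonsing_inv_mul _ hdet)
    rw [map_mul, map_one] at h1
    rw [← hm1]; exact h1
  set b : Fin n → ℂ := fun i => (B i : ℂ) with hb
  set c : Fin n → ℂ := fun i => (C i : ℂ) with hc
  set x := (z • (1 : Matrix (Fin n) (Fin n) ℂ) - Ac)⁻¹ *ᵥ b with hxdef
  have hx : (z • (1 : Matrix (Fin n) (Fin n) ℂ) - Ac) *ᵥ x = b := by
    rw [hxdef, Matrix.mulVec_mulVec,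
      Matrix.mul_nonsing_inv _ ((Matrix.isUnit_iff_isUnit_det _).1 hu1), Matrix.one_mulVec]
  have hAb : ∀ k i, ((((A ^ k) *ᵥ B) i : ℝ) : ℂ) = ((Ac ^ k) *ᵥ b) i := by
    intro k i
    rw [← hmap]
    simp [Matrix.mulVec, dotProduct, hb]
  have hG : ((liftedG n N A B).map Complex.ofReal) *ᵥ (fun q : Fin N => z ^ (q : ℕ)) =
      (1 - Ac ^ N) *ᵥ x := by
    have h := geomAux Ac z N x b hx
    rw [hz, one_smul] at h
    rw [Matrix.sub_mulVec, Matrix.one_mulVec, ← h]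
    ext i
    rw [Finset.sum_apply, ← Fin.sum_univ_eq_sum_range
      (fun q => (z ^ q • (Ac ^ (N - 1 - q)) *ᵥ b) i) N]
    simp only [Matrix.mulVec, dotProduct, Matrix.map_apply]
    refine Finset.sum_congr rfl fun q _ => ?_
    have := hAb (N - 1 - q) i
    simp only [liftedG, Matrix.of_apply, this]
    simp [Matrix.mulVec, dotProduct, mul_comm]
  have hJ : (((liftedJ n N A B C D).map Complex.ofReal) *ᵥ (fun q : Fin N => z ^ (q : ℕ))) p =
      D * z ^ (p : ℕ) + c ⬝ᵥ (z ^ (p : ℕ) • x - (Ac ^ (p : ℕ)) *ᵥ x) := by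
    rw [← geomAux Ac z p x b hx, dotProduct_sum]
    simp only [Matrix.mulVec, dotProduct, Matrix.map_apply, liftedJ, Matrix.of_apply]
    have hcv : ∀ k, ((∑ i, C i * ∑ j, (A ^ k) i j * B j : ℝ) : ℂ) = c ⬝ᵥ ((Ac ^ k) *ᵥ b) := by
      intro k
      rw [← hmap]
      simp [Matrix.mulVec, dotProduct, hb, hc]
    rw [Fin.sum_univ_eq_sum_range (fun q : ℕ => ((if (p : ℕ) = q then D
      else if q < (p : ℕ) then ∑ i, C i * ∑ j, (A ^ ((p : ℕ) - q - 1)) i j * B j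
      else 0 : ℝ) : ℂ) * z ^ q) N]
    have hsub : Finset.range ((p : ℕ) + 1) ⊆ Finset.range N := by
      intro q hq
      have := p.2
      simp only [Finset.mem_range] at *
      omega
    rw [← Finset.sum_subset hsub, Finset.sum_range_succ, if_pos rfl, add_comm]
    · congr 1
      refine Finset.sum_congr rfl fun q hq => ?_
      have hq' := Finset.mem_range.1 hq
      rw [if_neg (by omega), if_pos hq', hcv, Nat.sub_right_comm]
      have : c ⬝ᵥ (z ^ q • ((Ac ^ ((p : ℕ) - 1 - q)) *ᵥ b)) =
        c ⬝ᵥ ((Ac ^ ((p : ℕ) - 1 - q)) *ᵥ b) * z ^ q := by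
        rw [dotProduct_smul, smul_eq_mul, mul_comm]
      exact this.symm
    · intro q _ hq
      simp only [Finset.mem_range] at hq
      rw [if_neg (by omega), if_neg (by omega)]
      simp
  have hM : (periodicResponse n N A B C D).map Complex.ofReal =
      (liftedH n N A C).map Complex.ofReal * X * (liftedG n N A B).map Complex.ofReal
        + (liftedJ n N A B C D).map Complex.ofReal := by
    ext i j
    simp [periodicResponse, Matrix.mul_apply, hX]
  have hH : (((liftedH n N A C).map Complex.ofReal) *ᵥ x) p = c ⬝ᵥ ((Ac ^ (p : ℕ)) *ᵥ x) := by
    rw [Matrix.dotProduct_mulVec, ← hmap]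
    simp [Matrix.mulVec, Matrix.vecMul, dotProduct, liftedH, hc]
  rw [hM, Matrix.add_mulVec, ← Matrix.mulVec_mulVec, hG, Matrix.mulVec_mulVec, Matrix.mul_assoc,
    hXmul, Matrix.mul_one, Pi.add_apply, hH, hJ, dotProduct_sub, dotProduct_smul]
  have hT : transferFn n A B C D z = D + c ⬝ᵥ x := rfl
  rw [hT, smul_eq_mul]
  ring

/-- `𝓕_N^* M_N 𝓕_N` is diagonal with `m`-th diagonal entry
`P(e^{-iω_m})`, `ω_m = 2πm/N`. -/
theorem conjugated_periodicResponse_diagonal (n N : ℕ) (hN : 1 ≤ N)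
    (A : Matrix (Fin n) (Fin n) ℝ) (B C : Fin n → ℝ) (D : ℝ)
    (hA : ∀ μ ∈ spectrum ℂ (A.map Complex.ofReal), ‖μ‖ < 1) :
    (dftMatrix N)ᴴ * ((periodicResponse n N A B C D).map Complex.ofReal) * dftMatrix N =
      Matrix.diagonal fun m : Fin N =>
        transferFn n A B C D
          (Complex.exp (-(Complex.I * (2 * Real.pi * (m : ℕ) / N)))) := by
  have hMF : ((periodicResponse n N A B C D).map Complex.ofReal) * dftMatrix N =
      dftMatrix N * Matrix.diagonal fun m : Fin N =>
        transferFn n A B C D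
          (Complex.exp (-(Complex.I * (2 * Real.pi * (m : ℕ) / N)))) := by
    ext p m
    rw [Matrix.mul_diagonal]
    have hW : Complex.exp (-(Complex.I * (2 * Real.pi * (m : ℕ) / N))) =
        Complex.exp (-(2 * Real.pi * Complex.I) / N) ^ (m : ℕ) := by
      rw [← Complex.exp_nat_mul]
      congr 1
      ring
    rw [hW]
    have hz : (Complex.exp (-(2 * Real.pi * Complex.I) / N) ^ (m : ℕ)) ^ N = 1 := by
      rw [← pow_mul, mul_comm (m : ℕ), pow_mul, (dftAux_prim N hN).pow_eq_one, one_pow]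
    have h := eigenAux n N hN A B C D hA _ hz p
    simp only [dftMatrix, Matrix.of_apply, Matrix.mul_apply]
    rw [mul_comm (p : ℕ), pow_mul]
    refine Eq.trans ?_ (mul_assoc _ _ _).symm
    rw [← h]
    simp only [Matrix.mulVec, dotProduct]
    rw [Finset.mul_sum]
    refine Finset.sum_congr rfl fun q _ => ?_
    rw [mul_comm (q : ℕ), pow_mul]
    ring
  rw [Matrix.mul_assoc, hMF, ← Matrix.mul_assoc, dftAux_unitary N hN, Matrix.one_mul]

end
end

section
/- Let N ≥ 1. The periodic response matrix M_N := H(I−F)^{-1}G + J is a circulant matrix circ(a_0, a_1, …, a_{N−1}), i.e., its (p,q) entry equals a_{(q−p) mod N}, where a_0 = D + CA^{N−1}(I − A^N)^{-1}B and a_k = CA^{N−k−1}(I − A^N)^{-1}B for k = 1, …, N−1. -/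
open Matrix

noncomputable section

/-- The circulant matrix `circ(a_0, …, a_{N-1})` whose `(p,q)` entry is `a_{(q-p) mod N}`. -/
def circMatrix {N : ℕ} (a : Fin N → ℝ) : Matrix (Fin N) (Fin N) ℝ :=
  Matrix.of fun p q => a (q - p)

/-- The coefficients `a_0 = D + C A^{N-1} (I - A^N)⁻¹ B`,
`a_k = C A^{N-k-1} (I - A^N)⁻¹ B` for `k = 1, …, N-1`. -/
def circCoeffs (n N : ℕ) (A : Matrix (Fin n) (Fin n) ℝ) (B C : Fin n → ℝ) (D : ℝ) :
    Fin N → ℝ := fun k =>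
  if (k : ℕ) = 0 then D + C ⬝ᵥ ((A ^ (N - 1) * (1 - A ^ N)⁻¹) *ᵥ B)
  else C ⬝ᵥ ((A ^ (N - (k : ℕ) - 1) * (1 - A ^ N)⁻¹) *ᵥ B)

theorem aux_isUnit (n N : ℕ) (hN : 1 ≤ N) (A : Matrix (Fin n) (Fin n) ℝ)
    (hA : ∀ μ ∈ spectrum ℂ (A.map Complex.ofReal), ‖μ‖ < 1) :
    IsUnit (1 - A ^ N).det := by
  have h1 : (1 : ℂ) ∉ spectrum ℂ ((A.map Complex.ofReal) ^ N) := by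
    rw [spectrum.map_pow_of_pos _ (by omega : 0 < N)]
    rintro ⟨μ, hμ, h⟩
    have h2 := hA μ hμ
    have h3 : ‖μ‖ ^ N = 1 := by
      rw [← norm_pow]
      simpa using congrArg norm h
    have h4 := pow_lt_one₀ (norm_nonneg μ) h2 (by omega : N ≠ 0)
    linarith
  rw [spectrum.notMem_iff, map_one, Matrix.isUnit_iff_isUnit_det] at h1
  have h5 : (1 - (A.map Complex.ofReal) ^ N) = Complex.ofRealHom.mapMatrix (1 - A ^ N) := by
    rw [map_sub, map_pow, map_one]
    rfl
  rw [h5, ← RingHom.map_det] at h1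
  rw [isUnit_iff_ne_zero] at h1 ⊢
  intro h0
  apply h1
  rw [h0, map_zero]

theorem aux_comm (n N m : ℕ) (A : Matrix (Fin n) (Fin n) ℝ)
    (h : IsUnit (1 - A ^ N).det) :
    (1 - A ^ N)⁻¹ * A ^ m = A ^ m * (1 - A ^ N)⁻¹ := by
  have hc : A ^ m * (1 - A ^ N) = (1 - A ^ N) * A ^ m := by
    rw [mul_sub, sub_mul, ← pow_add, ← pow_add, add_comm m N, mul_one, one_mul]
  calc (1 - A ^ N)⁻¹ * A ^ m
      = (1 - A ^ N)⁻¹ * (A ^ m * (1 - A ^ N)) * (1 - A ^ N)⁻¹ := by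
        rw [mul_assoc, mul_assoc, Matrix.mul_nonsing_inv _ h, mul_one]
    _ = A ^ m * (1 - A ^ N)⁻¹ := by
        rw [hc, ← mul_assoc, Matrix.nonsing_inv_mul _ h, one_mul]

theorem aux_entry (n N : ℕ) (A R : Matrix (Fin n) (Fin n) ℝ) (B C : Fin n → ℝ) (p q : Fin N) :
    (liftedH n N A C * R * liftedG n N A B) p q
      = C ⬝ᵥ ((A ^ (p : ℕ) * R * A ^ (N - 1 - (q : ℕ))) *ᵥ B) := by
  have h : (liftedH n N A C * R * liftedG n N A B) p q
      = ((C ᵥ* (A ^ (p : ℕ))) ᵥ* R) ⬝ᵥ ((A ^ (N - 1 - (q : ℕ))) *ᵥ B) := rfl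
  rw [h, ← Matrix.mulVec_mulVec, Matrix.vecMul_vecMul, Matrix.dotProduct_mulVec C]

/-- the periodic response matrix `M_N = H(I-F)⁻¹G + J` is the
circulant matrix `circ(a_0, …, a_{N-1})` with the coefficients `a_k` above. -/
theorem periodicResponse_eq_circulant (n N : ℕ) (hN : 1 ≤ N)
    (A : Matrix (Fin n) (Fin n) ℝ) (B C : Fin n → ℝ) (D : ℝ)
    (hA : ∀ μ ∈ spectrum ℂ (A.map Complex.ofReal), ‖μ‖ < 1) :
    periodicResponse n N A B C D = circMatrix (circCoeffs n N A B C D) := by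
  have hu := aux_isUnit n N hN A hA
  ext p q
  have hp := p.isLt
  have hq := q.isLt
  have hR : A ^ N * (1 - A ^ N)⁻¹ + 1 = (1 - A ^ N)⁻¹ := by
    have := Matrix.mul_nonsing_inv _ hu
    rw [sub_mul, one_mul] at this
    exact (sub_eq_iff_eq_add'.1 this).symm
  have hk : ((q - p : Fin N) : ℕ) = if (p : ℕ) ≤ q then (q : ℕ) - p else N + q - p := by
    split_ifs with h
    · exact Fin.sub_val_of_le h
    · rw [Fin.coe_sub_iff_lt.2 (by simpa using h)]
  simp only [periodicResponse, Matrix.add_apply, aux_entry, circMatrix, circCoeffs, liftedJ,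
    Matrix.of_apply, hk]
  rw [mul_assoc, aux_comm n N _ A hu, ← mul_assoc, ← pow_add]
  rcases lt_trichotomy (p : ℕ) (q : ℕ) with h | h | h
  · rw [if_neg (by omega), if_neg (by omega), if_pos h.le, if_neg (by omega), add_zero]
    congr 4
    omega
  · rw [if_pos h, if_pos h.le, if_pos (by omega), add_comm]
    congr 5
    omega
  · rw [if_neg (by omega), if_pos h, if_neg (show ¬ (p : ℕ) ≤ q by omega), if_neg (by omega),
      ← dotProduct_add, ← Matrix.add_mulVec]
    have e1 : (p : ℕ) + (N - 1 - q) = (p - q - 1) + N := by omega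
    have e2 : N - (N + (q : ℕ) - p) - 1 = p - q - 1 := by omega
    rw [e1, e2, pow_add, mul_assoc]
    conv_rhs => rw [← hR]
    rw [mul_add, mul_one]

end
end

section
/- Let N ≥ 1, let ω_m = 2πm/N for m ∈ {0, 1, …, N−1}, and define a_0 = D + CA^{N−1}(I − A^N)^{-1}B and a_k = CA^{N−k−1}(I − A^N)^{-1}B for k = 1, …, N−1. Then Σ_{k=0}^{N−1} a_k e^{−iω_m k} = D + C(e^{−iω_m} I − A)^{-1} B, i.e., the discrete Fourier transform of the sequence (a_k) equals the sample P(e^{−iω_m}) of the transfer function P(z) = D + C(zI − A)^{-1}B. -/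
open Matrix Complex

noncomputable section

/-- the DFT of the coefficient sequence `(a_k)` equals the
transfer function sample: `Σ_{k=0}^{N-1} a_k e^{-iω_m k} = D + C (e^{-iω_m} I - A)⁻¹ B`,
where `ω_m = 2πm/N`. -/
theorem dft_circCoeffs_eq_transfer_sample (n N : ℕ) (hN : 1 ≤ N)
    (A : Matrix (Fin n) (Fin n) ℝ) (B C : Fin n → ℝ) (D : ℝ)
    (hA : ∀ μ ∈ spectrum ℂ (A.map Complex.ofReal), ‖μ‖ < 1) (m : Fin N) :
    ∑ k : Fin N, (circCoeffs n N A B C D k : ℂ) *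
        Complex.exp (-(Complex.I * (2 * Real.pi * (m : ℕ) / N)) * (k : ℕ)) =
      transferFn n A B C D (Complex.exp (-(Complex.I * (2 * Real.pi * (m : ℕ) / N)))) := by
  set z : ℂ := Complex.exp (-(Complex.I * (2 * Real.pi * (m : ℕ) / N))) with hz
  have hN0 : (N : ℂ) ≠ 0 := by
    have : N ≠ 0 := by omega
    exact_mod_cast this
  have hzN : z ^ N = 1 := by
    rw [hz, ← Complex.exp_nat_mul, Complex.exp_eq_one_iff]
    refine ⟨-((m : ℕ) : ℤ), ?_⟩
    push_cast
    field_simp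
  have hzn : ‖z‖ = 1 := Complex.norm_eq_one_of_pow_eq_one hzN (by omega)
  have hexp : ∀ k : ℕ, Complex.exp (-(Complex.I * (2 * Real.pi * (m : ℕ) / N)) * k) = z ^ k := by
    intro k
    rw [hz, ← Complex.exp_nat_mul, mul_comm]
  set M : Matrix (Fin n) (Fin n) ℂ := A.map Complex.ofReal with hM
  let f : Matrix (Fin n) (Fin n) ℝ →+* Matrix (Fin n) (Fin n) ℂ := Complex.ofRealHom.mapMatrix
  have hf : f A = M := rfl
  -- invertibility of `1 - A ^ N`
  have hunitC : IsUnit (1 - M ^ N) := by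
    by_contra h
    have h1 : (1 : ℂ) ∈ spectrum ℂ (M ^ N) := by
      rw [spectrum.mem_iff]
      simpa using h
    rw [spectrum.map_pow_of_pos M (by omega : 0 < N)] at h1
    obtain ⟨μ, hμ, hμN⟩ := h1
    have h2 : ‖μ‖ = 1 := Complex.norm_eq_one_of_pow_eq_one hμN (by omega)
    have := hA μ hμ
    linarith
  have hfN : f (1 - A ^ N) = 1 - M ^ N := by
    rw [map_sub, map_one, map_pow, hf]
  have hdet : IsUnit (1 - A ^ N).det := by
    have h1 := (Matrix.isUnit_iff_isUnit_det _).1 hunitC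
    rw [← hfN] at h1
    have h2 : (f (1 - A ^ N)).det = (((1 - A ^ N).det : ℝ) : ℂ) :=
      (RingHom.map_det Complex.ofRealHom (1 - A ^ N)).symm
    rw [h2, isUnit_iff_ne_zero] at h1
    rw [isUnit_iff_ne_zero]
    exact_mod_cast h1
  set R := (1 - A ^ N)⁻¹ with hR
  have hRinv : (1 - M ^ N) * f R = 1 := by
    rw [← hfN, ← map_mul, hR, Matrix.mul_nonsing_inv _ hdet, map_one]
  -- the resolvent
  have hinv : (z • (1 : Matrix (Fin n) (Fin n) ℂ) - M)⁻¹
      = ∑ k ∈ Finset.range N, z ^ k • (M ^ (N - 1 - k) * f R) := by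
    apply Matrix.inv_eq_right_inv
    have hc : Commute (z • (1 : Matrix (Fin n) (Fin n) ℂ)) M :=
      (Commute.one_left M).smul_left z
    have := hc.mul_geom_sum₂ N
    rw [smul_pow, one_pow, hzN, one_smul] at this
    refine Eq.trans ?_ hRinv
    rw [← this, mul_assoc, Finset.sum_mul]
    refine congrArg _ ?_
    refine Finset.sum_congr rfl fun k _ => ?_
    rw [smul_pow, one_pow, smul_mul_assoc, one_mul, smul_mul_assoc]
  have hcast : ∀ X : Matrix (Fin n) (Fin n) ℝ, ((C ⬝ᵥ (X *ᵥ B) : ℝ) : ℂ)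
      = (fun i => (C i : ℂ)) ⬝ᵥ (f X *ᵥ fun i => (B i : ℂ)) := by
    intro X
    simp [dotProduct, Matrix.mulVec, f]
  have hcoef : ∀ k : Fin N, (circCoeffs n N A B C D k : ℂ) =
      (if (k : ℕ) = 0 then (D : ℂ) else 0) +
      (fun i => (C i : ℂ)) ⬝ᵥ ((M ^ (N - 1 - (k : ℕ)) * f R) *ᵥ fun i => (B i : ℂ)) := by
    intro k
    have h := hcast (A ^ (N - 1 - (k : ℕ)) * R)
    rw [map_mul, map_pow, hf] at h
    rw [← h]
    unfold circCoeffs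
    split_ifs with h0
    · rw [h0]
      push_cast
      rfl
    · rw [Nat.sub_right_comm, zero_add]
  unfold transferFn
  rw [hinv]
  simp only [hexp, hcoef, add_mul, Finset.sum_add_distrib]
  congr 1
  · rw [Finset.sum_eq_single (⟨0, by omega⟩ : Fin N)]
    · simp
    · intro b _ hb
      have : (b : ℕ) ≠ 0 := fun h => hb (Fin.ext h)
      simp [this]
    · simp
  · rw [Matrix.sum_mulVec, dotProduct_sum, ← Fin.sum_univ_eq_sum_range
      (fun k => (fun i => (C i : ℂ)) ⬝ᵥ ((z ^ k • (M ^ (N - 1 - k) * f R)) *ᵥ fun i => (B i : ℂ))) N]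
    refine Finset.sum_congr rfl fun k _ => ?_
    rw [Matrix.smul_mulVec, dotProduct_smul, smul_eq_mul, mul_comm]

end
end
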